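/- arXiv:2604.25446 — 3 statements merged into one kernel-verified Lean document; each statement's English description precedes it below -/
import Mathlib

section
/- For every real ε with 0 < ε < 1 there exists a constant C > 0 such that a(x) ≥ C · x^{1−ε} for all integers x ≥ 2. -/
/-- The divisor-counting function on ℤ: number of positive divisors for m ≥ 1, and 0 for m ≤ 0. -/
def tau (m : ℤ) : ℕ := m.toNat.divisors.card

lemma succ_le_mul_rpow {ε : ℝ} (hε : 0 < ε) {p : ℕ} (hp : 2 ≤ p) (e : ℕ) :
    (e : ℝ) + 1 ≤ (1 + 1 / (ε * Real.log 2)) * (p : ℝ) ^ (ε * e) := by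
  have hp' : (2 : ℝ) ≤ p := by exact_mod_cast hp
  have hlog : 0 < ε * Real.log 2 := mul_pos hε (Real.log_pos one_lt_two)
  have h1 : ε * Real.log 2 * e + 1 ≤ (2 : ℝ) ^ (ε * e) := by
    rw [Real.rpow_def_of_pos two_pos]
    refine le_trans (le_of_eq ?_) (Real.add_one_le_exp _)
    ring
  have h2 : (2 : ℝ) ^ (ε * e) ≤ (p : ℝ) ^ (ε * e) :=
    Real.rpow_le_rpow two_pos.le hp' (by positivity)
  calc (e : ℝ) + 1 ≤ (1 + 1 / (ε * Real.log 2)) * (ε * Real.log 2 * e + 1) := by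
        have : (1 + 1 / (ε * Real.log 2)) * (ε * Real.log 2 * e + 1)
            = e + 1 + (ε * Real.log 2 * e + 1 / (ε * Real.log 2)) := by
          generalize ε * Real.log 2 = c at hlog
          field_simp
          ring
        rw [this]
        have : 0 ≤ ε * Real.log 2 * e + 1 / (ε * Real.log 2) := by positivity
        linarith
    _ ≤ _ := by
        gcongr
        exact h1.trans h2

lemma succ_le_rpow_of_two_le_rpow {ε : ℝ} {p : ℕ} (hp : 2 ≤ (p : ℝ) ^ ε) (e : ℕ) :
    (e : ℝ) + 1 ≤ (p : ℝ) ^ (ε * e) := by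
  rw [Real.rpow_mul_natCast p.cast_nonneg]
  calc (e : ℝ) + 1 ≤ 2 ^ e := by exact_mod_cast Nat.lt_two_pow_self (n := e)
    _ ≤ _ := by gcongr

/-- The divisor bound `τ(n) ≪ n ^ ε`. -/
theorem exists_card_divisors_le_mul_rpow {ε : ℝ} (hε : 0 < ε) :
    ∃ C : ℝ, 0 < C ∧ ∀ n : ℕ, (n.divisors.card : ℝ) ≤ C * (n : ℝ) ^ ε := by
  set K : ℝ := 1 + 1 / (ε * Real.log 2) with hK
  have hlog : 0 < ε * Real.log 2 := mul_pos hε (Real.log_pos one_lt_two)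
  have hK1 : 1 ≤ K := by
    rw [hK]
    have : 0 ≤ 1 / (ε * Real.log 2) := by positivity
    linarith
  obtain ⟨N, hN⟩ := exists_nat_ge ((2 : ℝ) ^ (1 / ε))
  have hlarge (p : ℕ) (hp : N ≤ p) : 2 ≤ (p : ℝ) ^ ε := by
    have h : (2 : ℝ) ^ (1 / ε) ≤ p := hN.trans (by exact_mod_cast hp)
    calc (2 : ℝ) = ((2 : ℝ) ^ (1 / ε)) ^ ε := by
          rw [← Real.rpow_mul two_pos.le, one_div_mul_cancel hε.ne', Real.rpow_one]
      _ ≤ _ := Real.rpow_le_rpow (by positivity) h hε.le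
  refine ⟨K ^ N, by positivity, fun n ↦ ?_⟩
  rcases eq_or_ne n 0 with rfl | hn
  · simp [hε.ne']
  have hpow : (n : ℝ) ^ ε = ∏ p ∈ n.primeFactors, (p : ℝ) ^ (ε * n.factorization p) := by
    conv_lhs => rw [← Nat.prod_factorization_pow_eq_self hn]
    rw [Finsupp.prod, Nat.support_factorization, Nat.cast_prod,
      ← Real.finsetProd_rpow _ _ (fun p _ ↦ by positivity)]
    refine Finset.prod_congr rfl fun p _ ↦ ?_
    rw [Nat.cast_pow, ← Real.rpow_natCast, ← Real.rpow_mul p.cast_nonneg, mul_comm]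
  have hconst : ∏ p ∈ n.primeFactors, (if p < N then K else 1) ≤ K ^ N := by
    rw [← Finset.prod_filter, Finset.prod_const]
    refine pow_le_pow_right₀ hK1 ?_
    calc _ ≤ (Finset.range N).card := Finset.card_le_card fun p hp ↦ by
          simpa using (Finset.mem_filter.1 hp).2
      _ = N := Finset.card_range N
  rw [Nat.card_divisors hn, Nat.cast_prod]
  calc ∏ p ∈ n.primeFactors, ((n.factorization p + 1 : ℕ) : ℝ)
      ≤ ∏ p ∈ n.primeFactors,
          ((if p < N then K else 1) * (p : ℝ) ^ (ε * n.factorization p)) := by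
        refine Finset.prod_le_prod (fun p _ ↦ by positivity) fun p hp ↦ ?_
        push_cast
        split_ifs with h
        · exact succ_le_mul_rpow hε (Nat.prime_of_mem_primeFactors hp).two_le _
        · rw [one_mul]
          exact succ_le_rpow_of_two_le_rpow (hlarge p (not_lt.1 h)) _
    _ ≤ K ^ N * (n : ℝ) ^ ε := by
        rw [Finset.prod_mul_distrib, ← hpow]
        gcongr

lemma tau_pos {m : ℤ} (hm : 0 < m) : 0 < tau m :=
  Finset.card_pos.2 ⟨1, Nat.one_mem_divisors.2 (by omega)⟩

lemma exists_orbit_nonpos {n : ℕ → ℤ} (hn : ∀ j, n (j + 1) = n j - tau (n j)) :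
    ∃ k, n k ≤ 0 := by
  by_contra! h
  have hle (k : ℕ) : n k ≤ n 0 - k := by
    induction k with
    | zero => simp
    | succ k ih =>
      have := tau_pos (h k)
      rw [hn]
      push_cast
      omega
  have h1 := hle (n 0).toNat
  have h2 := h (n 0).toNat
  have h3 := h 0
  omega

/-- For every 0 < ε < 1 there is a constant C > 0 such that the orbit length
a(x) = min{k : n_k ≤ 0} satisfies a(x) ≥ C · x^{1-ε} for all integers x ≥ 2. -/
theorem orbit_length_ge_pow (ε : ℝ) (hε0 : 0 < ε) (hε1 : ε < 1) :
    ∃ C : ℝ, 0 < C ∧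
      ∀ x : ℤ, 2 ≤ x →
        ∀ n : ℕ → ℤ, n 0 = x → (∀ j, n (j + 1) = n j - tau (n j)) →
          C * (x : ℝ) ^ (1 - ε) ≤ ((sInf {k : ℕ | n k ≤ 0} : ℕ) : ℝ) := by
  obtain ⟨D, hD, hbound⟩ := exists_card_divisors_le_mul_rpow hε0
  refine ⟨D⁻¹, inv_pos.2 hD, fun x hx n h0 hn ↦ ?_⟩
  have hx0 : (0 : ℝ) < x := by exact_mod_cast (by omega : 0 < x)
  have hle (j : ℕ) : n j ≤ x := by
    induction j with
    | zero => exact h0.le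
    | succ j ih => rw [hn]; omega
  have htau (j : ℕ) : (tau (n j) : ℝ) ≤ D * (x : ℝ) ^ ε := by
    refine (hbound _).trans ?_
    have : (((n j).toNat : ℤ) : ℝ) ≤ x := by
      have := hle j
      exact_mod_cast (by omega : ((n j).toNat : ℤ) ≤ x)
    rw [Int.cast_natCast] at this
    gcongr
  have hlower (k : ℕ) : (x : ℝ) - k * (D * (x : ℝ) ^ ε) ≤ n k := by
    induction k with
    | zero => simp [h0]
    | succ k ih =>
      have := htau k
      rw [hn]
      push_cast
      linarith
  set k := sInf {k : ℕ | n k ≤ 0}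
  have hk : n k ≤ 0 := Nat.sInf_mem (exists_orbit_nonpos hn)
  have hk' : (n k : ℝ) ≤ 0 := by exact_mod_cast hk
  have hmain := hlower k
  have hxε : 0 < (x : ℝ) ^ ε := Real.rpow_pos_of_pos hx0 ε
  rw [Real.rpow_sub hx0, Real.rpow_one, inv_mul_eq_div, div_div, div_le_iff₀ (by positivity)]
  linarith
end

section
/- Hitting bound: let x, N, L be positive integers and let A be a set of integers with A ⊆ (N, 2N] such that τ(m) ≥ L for all m ∈ A. Then the number of indices j with n_j ∈ A satisfies #{j ∈ ℕ : n_j ∈ A} · L ≤ N + L, i.e. the orbit visits A at most N/L + 1 times. -/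
open Classical in
/-- An invariant for a non-increasing integer sequence that drops by at least `L` at each visit
to a set `A ⊆ (N, 2N]`. -/
theorem visits_card_mul_le {n : ℕ → ℤ} {N L : ℕ} {A : Set ℤ}
    (hmono : ∀ j, n (j + 1) ≤ n j) (hdrop : ∀ j, n j ∈ A → n (j + 1) ≤ n j - L)
    (hA : ∀ m ∈ A, (N : ℤ) < m ∧ m ≤ 2 * N) (k : ℕ) :
    ({j ∈ Finset.range k | n j ∈ A}.card * L ≤ N + L) ∧
      ({j ∈ Finset.range k | n j ∈ A}.card = 0 ∨
        ({j ∈ Finset.range k | n j ∈ A}.card * L : ℤ) + n k ≤ 2 * N) := by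
  induction k with
  | zero => simp
  | succ k ih =>
    have hm := hmono k
    rw [Finset.range_add_one, Finset.filter_insert]
    split_ifs with h
    · rw [Finset.card_insert_of_notMem (by simp)]
      obtain ⟨hl, hu⟩ := hA _ h
      have hd := hdrop k h
      generalize ({j ∈ Finset.range k | n j ∈ A}).card = c at ih ⊢
      obtain ⟨-, rfl | ih⟩ := ih
      · refine ⟨by omega, Or.inr ?_⟩
        push_cast
        linarith
      · refine ⟨?_, Or.inr ?_⟩
        · zify
          linarith
        · push_cast
          linarith
    · exact ⟨ih.1, ih.2.imp_right fun h => by linarith⟩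

/-- Hitting bound: if A ⊆ (N, 2N] and τ(m) ≥ L for all m ∈ A, then the number of orbit
indices j with n_j ∈ A satisfies #{j : n_j ∈ A} · L ≤ N + L. -/
theorem orbit_hitting_bound (x : ℤ) (hx : 1 ≤ x)
    (n : ℕ → ℤ) (h0 : n 0 = x) (hrec : ∀ j, n (j + 1) = n j - tau (n j))
    (N L : ℕ) (hN : 0 < N) (hL : 0 < L)
    (A : Set ℤ) (hA : ∀ m ∈ A, (N : ℤ) < m ∧ m ≤ 2 * N)
    (hAL : ∀ m ∈ A, L ≤ tau m) :
    {j : ℕ | n j ∈ A}.ncard * L ≤ N + L := by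
  classical
  rcases Set.finite_or_infinite {j : ℕ | n j ∈ A} with hfin | hinf
  · obtain ⟨k, hk⟩ := hfin.bddAbove
    have hset : {j : ℕ | n j ∈ A} = ({j ∈ Finset.range (k + 1) | n j ∈ A} : Finset ℕ) := by
      ext j
      simp only [Set.mem_ofPred_eq, Finset.coe_filter, Finset.mem_range]
      exact ⟨fun h => ⟨Nat.lt_succ_of_le (hk h), h⟩, fun h => h.2⟩
    rw [hset, Set.ncard_coe_finset]
    convert (visits_card_mul_le (n := n) (L := L) (fun j => ?_) (fun j hj => ?_) hA (k + 1)).1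
    · rw [hrec]
      omega
    · rw [hrec]
      have := hAL _ hj
      omega
  · simp [hinf.ncard]
end

section
/- Energy bound on subsets: let x, N, L, U be positive integers and let A be a set of integers with A ⊆ (N, 2N] such that L ≤ τ(m) ≤ U for all m ∈ A. Then ∑_{j : n_j ∈ A} τ(n_j) · L ≤ U · (N + L), i.e. the total energy the orbit spends on A is at most (N/L + 1)·U. -/
/-- If every visit of the orbit to `A ⊆ (N, 2N]` moves it down by at least `L`, then the number of
visits before time `k`, times `L`, is at most `N + L`. -/
theorem card_visits_mul_le (n : ℕ → ℤ) (hrec : ∀ j, n (j + 1) = n j - tau (n j))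
    (N L : ℕ) (A : Set ℤ) [DecidablePred (· ∈ A)] (hA : ∀ m ∈ A, (N : ℤ) < m ∧ m ≤ 2 * N)
    (hAL : ∀ m ∈ A, L ≤ tau m) (k : ℕ) :
    ((Finset.range k).filter (fun j => n j ∈ A)).card * L ≤ N + L := by
  suffices h : ((Finset.range k).filter (fun j => n j ∈ A)).card * L ≤ N + L ∧
      (((Finset.range k).filter (fun j => n j ∈ A)).card = 0 ∨
        ((((Finset.range k).filter (fun j => n j ∈ A)).card * L : ℕ) : ℤ) ≤ 2 * N - n k) from h.1
  induction k with
  | zero => simp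
  | succ k ih =>
    have hk := hrec k
    rw [Finset.range_add_one, Finset.filter_insert]
    split_ifs with hmem
    · rw [Finset.card_insert_of_notMem (by simp), add_one_mul]
      have h1 := hA _ hmem
      have h2 := hAL _ hmem
      obtain ⟨-, h | h⟩ := ih
      · rw [h, zero_mul]
        omega
      · omega
    · omega

/-- Energy bound on subsets: if A ⊆ (N, 2N] and L ≤ τ(m) ≤ U on A, then the total energy
the orbit spends on A satisfies (∑_{j : n_j ∈ A} τ(n_j)) · L ≤ U · (N + L). -/
theorem orbit_energy_bound (x : ℤ) (hx : 1 ≤ x)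
    (n : ℕ → ℤ) (h0 : n 0 = x) (hrec : ∀ j, n (j + 1) = n j - tau (n j))
    (N L U : ℕ) (hN : 0 < N) (hL : 0 < L) (hU : 0 < U)
    (A : Set ℤ) (hA : ∀ m ∈ A, (N : ℤ) < m ∧ m ≤ 2 * N)
    (hAL : ∀ m ∈ A, L ≤ tau m ∧ tau m ≤ U) :
    (∑ᶠ j ∈ {j : ℕ | n j ∈ A}, tau (n j)) * L ≤ U * (N + L) := by
  classical
  by_cases hfin : {j : ℕ | n j ∈ A}.Finite
  · obtain ⟨b, hb⟩ := hfin.bddAbove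
    have hS : {j : ℕ | n j ∈ A} = ↑((Finset.range (b + 1)).filter (fun j => n j ∈ A)) := by
      ext j
      simpa using fun hj => Nat.lt_succ_of_le (hb hj)
    rw [hS, finsum_mem_coe_finset]
    have hsum := Finset.sum_le_card_nsmul ((Finset.range (b + 1)).filter (fun j => n j ∈ A))
      (fun j => tau (n j)) U (fun j hj => (hAL _ (Finset.mem_filter.mp hj).2).2)
    have hcard := card_visits_mul_le n hrec N L A hA (fun m hm => (hAL m hm).1) (b + 1)
    rw [smul_eq_mul] at hsum
    calc _ ≤ _ * U * L := Nat.mul_le_mul_right L hsum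
      _ = U * (_ * L) := by ring
      _ ≤ U * (N + L) := Nat.mul_le_mul_left U hcard
  · rw [finsum_mem_eq_zero_of_infinite]
    · simp
    · have hsub : {j : ℕ | n j ∈ A} ⊆ Function.support fun j => tau (n j) := fun j hj =>
        (hL.trans_le (hAL _ hj).1).ne'
      rwa [Set.inter_eq_left.mpr hsub]
end
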